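/- Let K be a field of characteristic 2 and V a K-vector space of dimension 2m with symplectic basis x_1,y_1,...,x_m,y_m and form f, DV its divided power algebra with differential ∂ given by multiplication by ω = x_1y_1 + ... + x_my_m. For k ≥ 0 let (D_kV)^{(1)} be the Frobenius twist of D_kV, on which g ∈ Sp(V) acts via the matrix g^{[2]} obtained by squaring all entries of g in the given basis. Then the map (D_kV)^{(1)} ⊗ H^m(DV) → H^{m+2k}(DV) induced by (u, v + Im ∂_{m−2}) ↦ u' v + Im ∂_{m+2k−2}, where u' ∈ D_{2k}V is obtained from u by doubling all exponents of each monomial, is a well-defined isomorphism of Sp(V)-modules; that is, H^{m+2k}(DV) ≅ (D_kV)^{(1)} ⊗ H^m(DV) as Sp(V)-modules. -/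

import Mathlib

noncomputable section

open Finsupp TensorProduct

/-- The underlying space of the divided power algebra `DV` of a vector space `V` with basis
indexed by `ι`: the free `K`-module on the set of multi-indices, where a multi-index
`a : ι →₀ ℕ` corresponds to the basis monomial `∏ᵢ vᵢ^{(a i)}`. -/
abbrev DPA (K ι : Type) [Field K] := (ι →₀ ℕ) →₀ K

/-- Total degree of a multi-index. -/
def deg {ι : Type} (a : ι →₀ ℕ) : ℕ := a.sum fun _ e => e

/-- The degree-`k` homogeneous component `D_k V` of the divided power algebra. -/
def Dsub (K ι : Type) [Field K] (k : ℕ) : Submodule K (DPA K ι) :=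
  Submodule.span K {f | ∃ a : ι →₀ ℕ, deg a = k ∧ f = Finsupp.single a (1 : K)}

/-- The structure constant of the divided power algebra:
`(∏ᵢ vᵢ^{(a i)}) ⬝ (∏ᵢ vᵢ^{(b i)}) = (∏ᵢ C(a i + b i, a i)) • ∏ᵢ vᵢ^{(a i + b i)}`. -/
def dpCoef {ι : Type} (a b : ι →₀ ℕ) : ℕ :=
  (a + b).prod fun i _ => Nat.choose (a i + b i) (a i)

/-- Multiplication of the divided power algebra, as a bilinear map. -/
def dpMul (K ι : Type) [Field K] : DPA K ι →ₗ[K] DPA K ι →ₗ[K] DPA K ι :=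
  Finsupp.lsum K fun a => LinearMap.toSpanSingleton K _
    (Finsupp.lsum K fun b => LinearMap.toSpanSingleton K _
      ((dpCoef a b : K) • Finsupp.single (a + b) (1 : K)))

/-- Divided power `w^{(n)} ∈ D_n V` of a vector `w = ∑ᵢ wᵢ vᵢ ∈ V`; it is determined by the
rules `(u+v)^{(a)} = ∑ u^{(i)} v^{(a-i)}` and `(t u)^{(a)} = tᵃ u^{(a)}`. -/
def dpow {K ι : Type} [Field K] [Fintype ι] [DecidableEq ι] (w : ι → K) (n : ℕ) : DPA K ι :=
  ∑ c ∈ Finset.univ.finsuppAntidiag n, Finsupp.single c (c.prod fun i e => w i ^ e)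

/-- The image `∏ᵢ (g vᵢ)^{(a i)}` of the basis monomial `∏ᵢ vᵢ^{(a i)}` under the algebra
endomorphism of `DV` induced by the matrix `g`. -/
def actMon {K ι : Type} [Field K] [Fintype ι] [DecidableEq ι]
    (g : Matrix ι ι K) (a : ι →₀ ℕ) : DPA K ι :=
  (a.support.toList.map fun i => dpow (fun j => g j i) (a i)).foldr
    (fun p q => dpMul K ι p q) (Finsupp.single 0 1)

/-- The algebra endomorphism of `DV` induced by the matrix `g` acting on `V` in the given
basis (for `g` invertible this is the induced algebra automorphism of `DV`). -/
def act {K ι : Type} [Field K] [Fintype ι] [DecidableEq ι] (g : Matrix ι ι K) :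
    DPA K ι →ₗ[K] DPA K ι :=
  Finsupp.lsum K fun a => LinearMap.toSpanSingleton K _ (actMon g a)

/-- The entrywise square of a matrix (giving the Frobenius twist of a representation
in characteristic 2). -/
def matSq {K ι : Type} [Field K] (g : Matrix ι ι K) : Matrix ι ι K :=
  fun i j => g i j * g i j

/-! Symplectic setting: `V` has dimension `2m` and symplectic basis `x_1,y_1,…,x_m,y_m`
indexed by `Fin m × Bool`, with `x_i = (i, false)` and `y_i = (i, true)`. -/

/-- The multi-index of the monomial `x_i y_i`. -/
def xyIdx (m : ℕ) (i : Fin m) : (Fin m × Bool) →₀ ℕ :=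
  Finsupp.single (i, false) 1 + Finsupp.single (i, true) 1

/-- The element `ω = x_1 y_1 + ⋯ + x_m y_m ∈ D_2 V`. -/
def omegaDP (K : Type) [Field K] (m : ℕ) : DPA K (Fin m × Bool) :=
  ∑ i : Fin m, Finsupp.single (xyIdx m i) (1 : K)

/-- The differential `∂` of the complex `DV`: multiplication by `ω`.  It restricts to
`∂_k : D_k V → D_{k+2} V`. -/
def del (K : Type) [Field K] (m : ℕ) :
    DPA K (Fin m × Bool) →ₗ[K] DPA K (Fin m × Bool) :=
  dpMul K (Fin m × Bool) (omegaDP K m)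

/-- The matrix of the non-degenerate alternating bilinear form `f` with `f(x_i, y_j) = δᵢⱼ`,
`f(x_i, x_j) = f(y_i, y_j) = 0`. -/
def Jmat (K : Type) [Field K] (m : ℕ) : Matrix (Fin m × Bool) (Fin m × Bool) K :=
  fun p q => if p.1 = q.1 ∧ p.2 ≠ q.2 then 1 else 0

/-- The condition that the matrix `g` belongs to the symplectic group `Sp(V)`:
`g` preserves the form `f`, i.e. `f(gu, gv) = f(u, v)` for all `u, v ∈ V`. -/
def IsSymplectic {K : Type} [Field K] {m : ℕ}
    (g : Matrix (Fin m × Bool) (Fin m × Bool) K) : Prop :=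
  g.transpose * Jmat K m * g = Jmat K m

/-- The cocycles in degree `k`: `ker ∂_k = ker ∂ ∩ D_k V`. -/
def Zmod (K : Type) [Field K] (m k : ℕ) : Submodule K (DPA K (Fin m × Bool)) :=
  LinearMap.ker (del K m) ⊓ Dsub K (Fin m × Bool) k

/-- The coboundaries in degree `k`: `Im ∂_{k-2} = ∂(D_{k-2} V)`.  (For `k = 0, 1`
truncated subtraction gives `∂(D_0 V) ⊆ D_2 V`, which meets `D_k V` only in `0`,
so no harm is done.) -/
def Bful (K : Type) [Field K] (m k : ℕ) : Submodule K (DPA K (Fin m × Bool)) :=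
  Submodule.map (del K m) (Dsub K (Fin m × Bool) (k - 2))

/-- The cohomology `H^k(DV) = ker ∂_k / Im ∂_{k-2}` of the complex `DV`, realized as the
image of `ker ∂_k` in `DV / Im ∂_{k-2}`. -/
abbrev Hcoh (K : Type) [Field K] (m k : ℕ) :=
  ↥(Submodule.map (Bful K m k).mkQ (Zmod K m k))

/-- The canonical projection `ker ∂_k → H^k(DV)`, sending a cocycle `z` to its
cohomology class `z + Im ∂_{k-2}`. -/
def toH (K : Type) [Field K] (m k : ℕ) : ↥(Zmod K m k) →ₗ[K] Hcoh K m k :=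
  LinearMap.codRestrict _ ((Bful K m k).mkQ.comp (Zmod K m k).subtype)
    (fun z => Submodule.mem_map_of_mem z.2)


section Alg

variable {K ι : Type} [Field K]

theorem dpMul_single (a b : ι →₀ ℕ) (r s : K) :
    dpMul K ι (Finsupp.single a r) (Finsupp.single b s)
      = Finsupp.single (a + b) (r * s * (dpCoef a b : K)) := by
  simp only [dpMul, Finsupp.lsum_single, LinearMap.toSpanSingleton_apply, LinearMap.smul_apply,
    Finsupp.smul_single, smul_eq_mul, mul_one, mul_assoc]

theorem dpCoef_eq [Fintype ι] (a b : ι →₀ ℕ) :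
    dpCoef a b = ∏ i, Nat.choose (a i + b i) (a i) := by
  unfold dpCoef Finsupp.prod
  apply Finset.prod_subset (Finset.subset_univ _)
  intro i _ hi
  have h : a i + b i = 0 := by simpa using hi
  have h1 : a i = 0 := by omega
  simp [h1]

theorem deg_eq [Fintype ι] (a : ι →₀ ℕ) : deg a = ∑ i, a i := by
  unfold deg
  rw [Finsupp.sum_fintype _ _ (fun i => rfl)]

theorem dpCoef_comm [Fintype ι] (a b : ι →₀ ℕ) : dpCoef a b = dpCoef b a := by
  rw [dpCoef_eq, dpCoef_eq]
  refine Finset.prod_congr rfl fun i _ => ?_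
  rw [add_comm (b i), Nat.choose_symm_add]

theorem dpCoef_assoc [Fintype ι] (a b c : ι →₀ ℕ) :
    dpCoef a b * dpCoef (a + b) c = dpCoef b c * dpCoef a (b + c) := by
  simp only [dpCoef_eq, ← Finset.prod_mul_distrib]
  refine Finset.prod_congr rfl fun i _ => ?_
  simp only [Finsupp.add_apply]
  have h := Nat.choose_mul (n := a i + b i + c i) (k := a i + b i) (s := a i) (by omega)
  have e1 : a i + b i + c i - a i = b i + c i := by omega
  have e2 : a i + b i - a i = b i := by omega
  rw [e1, e2] at h
  rw [mul_comm, h, mul_comm, add_assoc]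

theorem dpCoef_zero [Fintype ι] (b : ι →₀ ℕ) : dpCoef 0 b = 1 := by
  simp [dpCoef_eq]

theorem dpMul_comm [Fintype ι] (p q : DPA K ι) : dpMul K ι p q = dpMul K ι q p := by
  have : dpMul K ι = (dpMul K ι).flip := by
    ext a b : 4
    simp only [LinearMap.coe_comp, Function.comp_apply, Finsupp.lsingle_apply,
      LinearMap.flip_apply, dpMul_single, add_comm b a, dpCoef_comm b a]
  conv_lhs => rw [this]
  rfl

theorem dpMul_assoc [Fintype ι] (p q r : DPA K ι) :
    dpMul K ι (dpMul K ι p q) r = dpMul K ι p (dpMul K ι q r) := by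
  induction p using Finsupp.induction_linear with
  | zero => simp
  | add p p' h h' => simp [h, h']
  | single a x =>
  induction q using Finsupp.induction_linear with
  | zero => simp
  | add p p' h h' => simp [h, h']
  | single b y =>
  induction r using Finsupp.induction_linear with
  | zero => simp
  | add p p' h h' => simp [h, h']
  | single c z =>
  simp only [dpMul_single, add_assoc]
  congr 1
  have h : (dpCoef a b : K) * dpCoef (a + b) c = dpCoef b c * dpCoef a (b + c) := by
    exact_mod_cast congrArg (Nat.cast (R := K)) (dpCoef_assoc a b c)
  linear_combination (x * y * z) * h

theorem dpMul_one [Fintype ι] (p : DPA K ι) : dpMul K ι (Finsupp.single 0 1) p = p := by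
  induction p using Finsupp.induction_linear with
  | zero => simp
  | add p p' h h' => simp [h, h']
  | single a x => simp [dpMul_single, dpCoef_zero]

end Alg

/-- The divided power algebra as a commutative ring. -/
def DR (K ι : Type) [Field K] := DPA K ι

instance instDRGroup (K ι : Type) [Field K] : AddCommGroup (DR K ι) :=
  inferInstanceAs (AddCommGroup (DPA K ι))

instance instDRModule (K ι : Type) [Field K] : Module K (DR K ι) :=
  inferInstanceAs (Module K (DPA K ι))

instance instDRRing (K ι : Type) [Field K] [Fintype ι] : CommRing (DR K ι) :=
  { instDRGroup K ι with
    mul := fun p q => dpMul K ι p q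
    one := (Finsupp.single 0 1 : DPA K ι)
    mul_assoc := dpMul_assoc
    mul_comm := dpMul_comm
    one_mul := dpMul_one
    mul_one := fun p => (dpMul_comm _ _).trans (dpMul_one p)
    left_distrib := fun p q r => map_add (dpMul K ι p) q r
    right_distrib := fun p q r => LinearMap.map_add₂ (dpMul K ι) p q r
    zero_mul := fun p => LinearMap.map_zero₂ (dpMul K ι) p
    mul_zero := fun p => map_zero (dpMul K ι p) }

instance instDRAlg (K ι : Type) [Field K] [Fintype ι] : Algebra K (DR K ι) :=
  Algebra.ofModule (fun r x y => LinearMap.map_smul₂ (dpMul K ι) r x y)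
    (fun r x y => map_smul (dpMul K ι x) r y)

section Act

variable {K ι : Type} [Field K] [Fintype ι] [DecidableEq ι]

/-- Divided power as an element of the ring. -/
def rpow (w : ι → K) (n : ℕ) : DR K ι := dpow w n

/-- Monomials as elements of the ring. -/
def mon (a : ι →₀ ℕ) : DR K ι := (Finsupp.single a 1 : DPA K ι)

theorem mon_mul (a b : ι →₀ ℕ) :
    (mon a * mon b : DR K ι) = (dpCoef a b : K) • mon (a + b) := by
  change dpMul K ι (Finsupp.single a 1) (Finsupp.single b 1) = _
  rw [dpMul_single]
  change _ = (dpCoef a b : K) • (Finsupp.single (a + b) 1 : DPA K ι)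
  simp

theorem mon_zero : (mon 0 : DR K ι) = 1 := rfl

theorem dpow_eq (w : ι → K) (n : ℕ) :
    rpow w n = ∑ c ∈ Finset.univ.finsuppAntidiag n, (∏ i, w i ^ c i) • mon (K := K) c := by
  unfold rpow dpow
  refine Finset.sum_congr rfl fun c _ => ?_
  rw [Finsupp.prod_fintype _ _ (fun i => pow_zero _)]
  change _ = (∏ i, w i ^ c i) • (Finsupp.single c 1 : DPA K ι)
  simp

theorem rpow_zero (w : ι → K) : rpow w 0 = 1 := by
  rw [dpow_eq]
  simp [mon_zero]

theorem vandermonde_multi (e : ι → ℕ) (n : ℕ) :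
    ∑ c ∈ (Finset.univ : Finset ι).finsuppAntidiag n, ∏ i, (e i).choose (c i)
      = (∑ i, e i).choose n := by
  have h := PowerSeries.coeff_prod (R := ℤ) (fun i : ι => (1 + PowerSeries.X) ^ e i) n Finset.univ
  rw [Finset.prod_pow_eq_pow_sum] at h
  have h2 : ∀ a b : ℕ, PowerSeries.coeff b ((1 + PowerSeries.X : PowerSeries ℤ) ^ a)
      = (a.choose b : ℤ) := by
    intro a b
    have : ((1 + PowerSeries.X : PowerSeries ℤ) ^ a)
        = (((1 + Polynomial.X) ^ a : Polynomial ℤ) : PowerSeries ℤ) := by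
      simp
    rw [this, Polynomial.coeff_coe, Polynomial.coeff_one_add_X_pow]
  simp only [h2] at h
  exact_mod_cast h.symm

theorem rpow_mul (w : ι → K) (p q : ℕ) :
    rpow w p * rpow w q = ((p + q).choose p : K) • rpow w (p + q) := by
  have hV : ∀ e ∈ (Finset.univ : Finset ι).finsuppAntidiag (p + q),
      ∑ x ∈ ((Finset.univ : Finset ι).finsuppAntidiag p ×ˢ
        (Finset.univ : Finset ι).finsuppAntidiag q) with x.1 + x.2 = e,
        dpCoef x.1 x.2 = (p + q).choose p := by
    intro e he
    simp only [Finset.mem_finsuppAntidiag'] at he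
    have hs : ∑ i, e i = p + q := by
      rw [← he.1, Finsupp.sum_fintype _ _ (fun i => rfl)]
    rw [← hs, ← vandermonde_multi]
    symm
    rw [← Finset.sum_filter_add_sum_filter_not _ (fun c : ι →₀ ℕ => c ≤ e)]
    have h0 : ∑ c ∈ (Finset.univ : Finset ι).finsuppAntidiag p with ¬ c ≤ e,
        ∏ i, (e i).choose (c i) = 0 := by
      refine Finset.sum_eq_zero fun c hc => ?_
      have hc := (Finset.mem_filter.1 hc).2
      have : ∃ i, e i < c i := by
        by_contra hcon
        push Not at hcon
        exact hc hcon
      obtain ⟨i, hi⟩ := this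
      exact Finset.prod_eq_zero (Finset.mem_univ i) (Nat.choose_eq_zero_of_lt hi)
    rw [h0, add_zero]
    refine Finset.sum_bij' (fun c _ => (c, e - c)) (fun x _ => x.1) ?_ ?_ ?_ ?_ ?_
    · intro c hc
      simp only [Finset.mem_filter, Finset.mem_product, Finset.mem_finsuppAntidiag] at hc ⊢
      refine ⟨⟨hc.1, ?_, by simp⟩, add_tsub_cancel_of_le hc.2⟩
      have h1 : Finset.univ.sum ⇑(e - c) + Finset.univ.sum c = p + q := by
        rw [← hs, ← Finset.sum_add_distrib]
        refine Finset.sum_congr rfl fun i _ => ?_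
        have := hc.2 i
        simp only [Finsupp.tsub_apply]; omega
      have := hc.1.1
      omega
    · intro x hx
      simp only [Finset.mem_filter, Finset.mem_product, Finset.mem_finsuppAntidiag] at hx ⊢
      exact ⟨hx.1.1, hx.2 ▸ le_self_add⟩
    · intro c hc; rfl
    · intro x hx
      simp only [Finset.mem_filter] at hx
      ext1
      · rfl
      · simp [← hx.2]
    · intro c hc
      have hc := (Finset.mem_filter.1 hc).2
      simp only [dpCoef_eq]
      refine Finset.prod_congr rfl fun i _ => ?_
      have := hc i
      simp only [Finsupp.tsub_apply, Nat.add_sub_cancel' this]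
  simp only [dpow_eq, Finset.sum_mul_sum, Finset.smul_sum]
  rw [← Finset.sum_product']
  rw [← Finset.sum_fiberwise_of_maps_to (t := (Finset.univ : Finset ι).finsuppAntidiag (p + q))
    (g := fun x => x.1 + x.2)]
  · refine Finset.sum_congr rfl fun e he => ?_
    rw [← hV e he, Nat.cast_sum, Finset.sum_smul]
    refine Finset.sum_congr rfl fun x hx => ?_
    have hx := (Finset.mem_filter.1 hx).2
    rw [smul_mul_smul_comm, mon_mul, smul_smul, smul_smul, hx, ← Finset.prod_mul_distrib, mul_comm]
    congr 2
    refine Finset.prod_congr rfl fun i _ => ?_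
    rw [← hx, ← pow_add]; rfl
  · intro x hx
    simp only [Finset.mem_product, Finset.mem_finsuppAntidiag] at hx ⊢
    refine ⟨?_, by simp⟩
    rw [← hx.1.1, ← hx.2.1, ← Finset.sum_add_distrib]
    rfl

/-- The image of a monomial in the ring. -/
def ract (g : Matrix ι ι K) (a : ι →₀ ℕ) : DR K ι := actMon g a

theorem ract_eq' (g : Matrix ι ι K) (a : ι →₀ ℕ) :
    ract g a = ∏ i ∈ a.support, rpow (fun j => g j i) (a i) := by
  rw [← Finset.prod_map_toList]
  rfl

theorem ract_eq (g : Matrix ι ι K) (a : ι →₀ ℕ) :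
    ract g a = ∏ i, rpow (fun j => g j i) (a i) := by
  rw [ract_eq']
  apply Finset.prod_subset (Finset.subset_univ _)
  intro i _ hi
  have h : a i = 0 := by simpa using hi
  rw [h, rpow_zero]

theorem ract_mul (g : Matrix ι ι K) (a b : ι →₀ ℕ) :
    ract g a * ract g b = (dpCoef a b : K) • ract g (a + b) := by
  simp only [ract_eq, dpCoef_eq, ← Finset.prod_mul_distrib, rpow_mul, Nat.cast_prod]
  rw [Finset.prod_smul]
  rfl

theorem act_single (g : Matrix ι ι K) (a : ι →₀ ℕ) (r : K) :
    act g (Finsupp.single a r) = r • actMon g a := by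
  simp [act]

theorem act_mul (g : Matrix ι ι K) (p q : DPA K ι) :
    act g (dpMul K ι p q) = dpMul K ι (act g p) (act g q) := by
  induction p using Finsupp.induction_linear with
  | zero => simp
  | add p p' h h' => simp [h, h']
  | single a x =>
  induction q using Finsupp.induction_linear with
  | zero => simp
  | add p p' h h' => simp [h, h']
  | single b y =>
  have h : dpMul K ι (actMon g a) (actMon g b) = (dpCoef a b : K) • actMon g (a + b) :=
    ract_mul g a b
  simp only [dpMul_single, act_single, map_smul, LinearMap.smul_apply, h, smul_smul]
  congr 1
  ring

end Act

section Half

variable {K ι : Type} [Field K] [Fintype ι] [DecidableEq ι]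

/-- Halving of exponents of a multi-index. -/
def halfIdx (e : ι →₀ ℕ) : ι →₀ ℕ := e.mapRange (fun n => n / 2) rfl

open Classical in
/-- Projection onto even monomials followed by halving exponents. -/
def half (K ι : Type) [Field K] : DPA K ι →ₗ[K] DPA K ι :=
  Finsupp.linearCombination K
    (fun e => if ∀ i, e i % 2 = 0 then Finsupp.single (halfIdx e) (1 : K) else 0)

/-- Doubling of exponents. -/
def dbl (K ι : Type) [Field K] : DPA K ι →ₗ[K] DPA K ι :=
  Finsupp.linearCombination K (fun e => Finsupp.single (e + e) (1 : K))

theorem dbl_single (e : ι →₀ ℕ) (r : K) :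
    dbl K ι (Finsupp.single e r) = Finsupp.single (e + e) r := by
  simp [dbl]

theorem half_single_even (e : ι →₀ ℕ) (r : K) (h : ∀ i, e i % 2 = 0) :
    half K ι (Finsupp.single e r) = Finsupp.single (halfIdx e) r := by
  simp [half, h]

theorem half_single_odd (e : ι →₀ ℕ) (r : K) (h : ¬ ∀ i, e i % 2 = 0) :
    half K ι (Finsupp.single e r) = 0 := by
  simp only [half, Finsupp.linearCombination_single, if_neg h, smul_zero]

theorem halfIdx_add (e : ι →₀ ℕ) : halfIdx (e + e) = e := by
  ext i
  simp only [halfIdx, Finsupp.mapRange_apply, Finsupp.add_apply]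
  omega

theorem halfIdx_dbl (e : ι →₀ ℕ) (h : ∀ i, e i % 2 = 0) : halfIdx e + halfIdx e = e := by
  ext i
  simp only [halfIdx, Finsupp.mapRange_apply, Finsupp.add_apply]
  have := h i
  omega

theorem half_dbl (p : DPA K ι) : half K ι (dbl K ι p) = p := by
  induction p using Finsupp.induction_linear with
  | zero => simp
  | add p p' h h' => simp [h, h']
  | single a x =>
    rw [dbl_single, half_single_even _ _ (fun i => by simp only [Finsupp.add_apply]; omega),
      halfIdx_add]

theorem choose_odd_odd (a b : ℕ) (ha : a % 2 = 1) (hb : b % 2 = 1) :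
    (a + b).choose a % 2 = 0 := by
  have h := Choose.choose_modEq_choose_mod_mul_choose_div_nat (p := 2) (n := a + b) (k := a)
  have h1 : (a + b) % 2 = 0 := by omega
  rw [h1, ha] at h
  simpa [Nat.ModEq] using h

theorem choose_even_even (a b : ℕ) (ha : a % 2 = 0) (hb : b % 2 = 0) :
    (a + b).choose a ≡ (a / 2 + b / 2).choose (a / 2) [MOD 2] := by
  have h := Choose.choose_modEq_choose_mod_mul_choose_div_nat (p := 2) (n := a + b) (k := a)
  have h1 : (a + b) % 2 = 0 := by omega
  have h2 : (a + b) / 2 = a / 2 + b / 2 := by omega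
  rw [h1, ha, h2] at h
  simpa using h

theorem dpCoef_odd_odd [CharP K 2] (a b : ι →₀ ℕ) (i : ι) (ha : a i % 2 = 1) (hb : b i % 2 = 1) :
    (dpCoef a b : K) = 0 := by
  rw [dpCoef_eq, Nat.cast_prod]
  refine Finset.prod_eq_zero (Finset.mem_univ i) ?_
  rw [CharP.cast_eq_zero_iff K 2]
  exact Nat.dvd_of_mod_eq_zero (choose_odd_odd _ _ ha hb)

theorem half_mul_odd [CharP K 2] (a b : ι →₀ ℕ) (r s : K) (ha : ¬ ∀ i, a i % 2 = 0) :
    half K ι (dpMul K ι (Finsupp.single a r) (Finsupp.single b s)) = 0 := by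
  rw [dpMul_single]
  by_cases hab : ∀ i, (a + b) i % 2 = 0
  · push Not at ha
    obtain ⟨i, hi⟩ := ha
    have h1 := hab i
    rw [Finsupp.add_apply] at h1
    rw [dpCoef_odd_odd a b i (by omega) (by omega)]
    simp
  · exact half_single_odd _ _ hab

theorem half_mul [CharP K 2] (p q : DPA K ι) :
    half K ι (dpMul K ι p q) = dpMul K ι (half K ι p) (half K ι q) := by
  induction p using Finsupp.induction_linear with
  | zero => simp
  | add p p' h h' => simp [h, h']
  | single a x =>
  induction q using Finsupp.induction_linear with
  | zero => simp
  | add p p' h h' => simp [h, h']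
  | single b y =>
  by_cases ha : ∀ i, a i % 2 = 0
  · by_cases hb : ∀ i, b i % 2 = 0
    · rw [half_single_even _ _ ha, half_single_even _ _ hb, dpMul_single, dpMul_single,
        half_single_even]
      · congr 1
        · ext i
          have := ha i
          have := hb i
          simp only [halfIdx, Finsupp.mapRange_apply, Finsupp.add_apply]
          omega
        · congr 1
          simp only [dpCoef_eq, Nat.cast_prod]
          refine Finset.prod_congr rfl fun i _ => ?_
          exact CharP.natCast_eq_natCast' K 2 (choose_even_even _ _ (ha i) (hb i))
      · intro i
        have := ha i
        have := hb i
        rw [Finsupp.add_apply]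
        omega
    · rw [half_single_odd _ _ hb, dpMul_comm, half_mul_odd _ _ _ _ hb]
      simp
  · rw [half_single_odd _ _ ha, half_mul_odd _ _ _ _ ha]
    simp

theorem dpow_eq_single (w : ι → K) (n : ℕ) :
    dpow w n = ∑ c ∈ Finset.univ.finsuppAntidiag n, Finsupp.single c (∏ i, w i ^ c i) := by
  unfold dpow
  refine Finset.sum_congr rfl fun c _ => ?_
  rw [Finsupp.prod_fintype _ _ (fun i => pow_zero _)]

theorem half_dpow (w : ι → K) (n : ℕ) :
    half K ι (dpow w (n + n)) = dpow (fun i => w i * w i) n := by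
  rw [dpow_eq_single, dpow_eq_single, map_sum]
  symm
  refine Finset.sum_of_injOn (fun c => c + c) ?_ ?_ ?_ ?_
  · intro c _ d _ h
    have := congrArg halfIdx h
    simpa only [halfIdx_add] using this
  · intro c hc
    simp only [Finset.mem_coe, Finset.mem_finsuppAntidiag] at hc ⊢
    refine ⟨?_, by simp⟩
    conv_rhs => rw [← hc.1]
    rw [← Finset.sum_add_distrib]
    rfl
  · intro c hc hc'
    apply half_single_odd
    intro h
    apply hc'
    refine ⟨halfIdx c, ?_, halfIdx_dbl c h⟩
    simp only [Finset.mem_coe, Finset.mem_finsuppAntidiag] at hc ⊢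
    refine ⟨?_, by simp⟩
    have h1 := hc.1
    conv_lhs at h1 => rw [← halfIdx_dbl c h]
    have h2 : Finset.univ.sum ⇑(halfIdx c + halfIdx c)
      = Finset.univ.sum ⇑(halfIdx c) + Finset.univ.sum ⇑(halfIdx c) := by
      rw [← Finset.sum_add_distrib]
      rfl
    omega
  · intro c hc
    rw [half_single_even _ _ (fun i => by simp only [Finsupp.add_apply]; omega), halfIdx_add]
    congr 1
    refine Finset.prod_congr rfl fun i _ => ?_
    rw [Finsupp.add_apply, pow_add, mul_pow]

theorem half_actMon [CharP K 2] (g : Matrix ι ι K) (a : ι →₀ ℕ) :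
    half K ι (actMon g (a + a)) = actMon (matSq g) a := by
  unfold actMon
  have hs : (a + a).support = a.support := by
    ext i
    simp
  rw [hs]
  induction a.support.toList with
  | nil =>
    simp only [List.map_nil, List.foldr_nil]
    rw [half_single_even _ _ (fun i => by simp)]
    congr 1
    ext i
    simp [halfIdx]
  | cons i l ih =>
    simp only [List.map_cons, List.foldr_cons]
    rw [half_mul, ih, Finsupp.add_apply, half_dpow]
    rfl

theorem half_act_dbl [CharP K 2] (g : Matrix ι ι K) (u : DPA K ι) :
    half K ι (act g (dbl K ι u)) = act (matSq g) u := by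
  induction u using Finsupp.induction_linear with
  | zero => simp
  | add p p' h h' => simp [h, h']
  | single a x =>
    rw [dbl_single, act_single, act_single, map_smul, half_actMon]

theorem rpow_one (w : ι → K) : rpow w 1 = ∑ p, w p • mon (Finsupp.single p 1) := by
  rw [dpow_eq]
  symm
  refine Finset.sum_bij (fun p _ => Finsupp.single p 1) ?_ ?_ ?_ ?_
  · intro p _
    simp
  · intro p _ q _ h
    exact Finsupp.single_left_injective one_ne_zero h
  · intro c hc
    have h1 := (Finset.mem_finsuppAntidiag'.1 hc).1
    obtain ⟨p, hp⟩ := (Finsupp.sum_eq_one_iff c).1 h1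
    exact ⟨p, Finset.mem_univ _, hp.symm⟩
  · intro p _
    congr 1
    rw [Finset.prod_eq_single p]
    · simp
    · intro q _ hq
      simp [Finsupp.single_apply, Ne.symm hq]
    · simp

theorem mon_sq [CharP K 2] (p : ι) :
    (mon (Finsupp.single p 1) * mon (Finsupp.single p 1) : DR K ι) = 0 := by
  rw [mon_mul, dpCoef_odd_odd _ _ p (by simp) (by simp), zero_smul]

end Half

section Sympl

variable {K : Type} [Field K] {m : ℕ}

theorem xyIdx_false (i j : Fin m) : xyIdx m i (j, false) = if i = j then 1 else 0 := by
  simp [xyIdx, Finsupp.single_apply]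

theorem xyIdx_true (i j : Fin m) : xyIdx m i (j, true) = if i = j then 1 else 0 := by
  simp [xyIdx, Finsupp.single_apply]

theorem Jmat_sq : Jmat K m * Jmat K m = 1 := by
  ext ⟨i, b⟩ ⟨j, c⟩
  rw [Matrix.mul_apply, Fintype.sum_prod_type, Finset.sum_eq_single i]
  · by_cases hij : i = j
    · subst hij
      cases b <;> cases c <;> simp [Jmat, Matrix.one_apply]
    · cases b <;> cases c <;> simp [Jmat, Matrix.one_apply, hij]
  · intro k _ hk
    simp [Jmat, Ne.symm hk]
  · simp

theorem symp_transpose (g : Matrix (Fin m × Bool) (Fin m × Bool) K) (hg : IsSymplectic g) :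
    g * Jmat K m * g.transpose = Jmat K m := by
  unfold IsSymplectic at hg
  have h1 : (Jmat K m * g.transpose * Jmat K m) * g = 1 := by
    calc Jmat K m * g.transpose * Jmat K m * g = Jmat K m * (g.transpose * Jmat K m * g) := by
          simp only [Matrix.mul_assoc]
      _ = 1 := by rw [hg, Jmat_sq]
  have h2 := mul_eq_one_comm.1 h1
  calc g * Jmat K m * g.transpose = g * (Jmat K m * g.transpose * Jmat K m) * Jmat K m := by
        simp only [Matrix.mul_assoc, Jmat_sq, Matrix.mul_one]
    _ = Jmat K m := by rw [h2, Matrix.one_mul]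

theorem mon_xy (i : Fin m) :
    (mon (xyIdx m i) : DR K (Fin m × Bool))
      = mon (Finsupp.single (i, false) 1) * mon (Finsupp.single (i, true) 1) := by
  rw [mon_mul]
  have : dpCoef (Finsupp.single (i, false) 1) (Finsupp.single ((i, true) : Fin m × Bool) 1) = 1 := by
    rw [dpCoef_eq]
    refine Finset.prod_eq_one fun p _ => ?_
    by_cases h1 : (i, false) = p
    · subst h1; simp
    · by_cases h2 : (i, true) = p
      · subst h2; simp
      · simp [Finsupp.single_apply, h1, h2]
  rw [this]
  simp [xyIdx]

theorem ract_xy (g : Matrix (Fin m × Bool) (Fin m × Bool) K) (i : Fin m) :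
    ract g (xyIdx m i) = rpow (fun j => g j (i, false)) 1 * rpow (fun j => g j (i, true)) 1 := by
  rw [ract_eq, Fintype.prod_prod_type, Finset.prod_eq_single i]
  · simp [xyIdx_false, xyIdx_true, mul_comm]
  · intro k _ hk
    simp [xyIdx_false, xyIdx_true, Ne.symm hk, rpow_zero]
  · simp

theorem quad_zero [CharP K 2] {ι : Type} [Fintype ι] [DecidableEq ι] (A : ι → ι → K)
    (hA : ∀ p q, A p q + A q p = 0) :
    ∑ x : ι × ι, A x.1 x.2 •
      (mon (Finsupp.single x.1 1) * mon (Finsupp.single x.2 1) : DR K ι) = 0 := by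
  refine Finset.sum_involution (fun x _ => (x.2, x.1)) ?_ ?_ ?_ ?_
  · intro x _
    dsimp only
    rw [mul_comm (mon (Finsupp.single x.2 1)), ← add_smul, hA, zero_smul]
  · intro x _ h hx
    apply h
    have : x.2 = x.1 := congrArg Prod.fst hx
    rw [this, mon_sq, smul_zero]
  · intro x _; exact Finset.mem_univ _
  · intro x _; rfl

theorem act_omega [CharP K 2] (g : Matrix (Fin m × Bool) (Fin m × Bool) K)
    (hg : IsSymplectic g) : act g (omegaDP K m) = omegaDP K m := by
  have h1 : act g (omegaDP K m) = (∑ i, ract g (xyIdx m i) : DR K (Fin m × Bool)) := by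
    unfold omegaDP
    rw [map_sum]
    refine Finset.sum_congr rfl fun i _ => ?_
    rw [act_single, one_smul]
    rfl
  have h2 : omegaDP K m = (∑ i, mon (xyIdx m i) : DR K (Fin m × Bool)) := rfl
  rw [h1, h2]
  let A : (Fin m × Bool) → (Fin m × Bool) → K := fun p q => ∑ i, g p (i, false) * g q (i, true)
  let N : (Fin m × Bool) → (Fin m × Bool) → K :=
    fun p q => if p.1 = q.1 ∧ p.2 = false ∧ q.2 = true then 1 else 0
  have hA : (∑ i, ract g (xyIdx m i) : DR K (Fin m × Bool))
      = ∑ x : (Fin m × Bool) × (Fin m × Bool), A x.1 x.2 •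
      (mon (Finsupp.single x.1 1) * mon (Finsupp.single x.2 1)) := by
    simp only [ract_xy, rpow_one, Finset.sum_mul_sum, A, Finset.sum_smul, smul_mul_smul_comm]
    rw [Finset.sum_comm]
    conv_rhs => rw [Fintype.sum_prod_type]
    refine Finset.sum_congr rfl fun p _ => ?_
    rw [Finset.sum_comm]
  have hN : (∑ i, mon (xyIdx m i) : DR K (Fin m × Bool))
      = ∑ x : (Fin m × Bool) × (Fin m × Bool), N x.1 x.2 •
      (mon (Finsupp.single x.1 1) * mon (Finsupp.single x.2 1)) := by
    refine Finset.sum_of_injOn (fun i => ((i, false), (i, true))) ?_ ?_ ?_ ?_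
    · intro i _ j _ h
      simpa using h
    · intro i _; simp
    · rintro ⟨⟨i, b⟩, ⟨j, c⟩⟩ _ h
      have : N (i, b) (j, c) = 0 := by
        simp only [N]
        rw [if_neg]
        rintro ⟨h1, h2, h3⟩
        apply h
        subst h1 h2 h3
        exact ⟨i, by simp⟩
      simp only [this, zero_smul]
    · intro i _
      simp [N, mon_xy]
  have hz := quad_zero (fun p q => A p q + N p q) (by
    intro p q
    have hT := congrFun (congrFun (symp_transpose g hg) p) q
    have hS : (g * Jmat K m * g.transpose) p q = A p q + A q p := by
      rw [Matrix.mul_assoc, Matrix.mul_apply, Fintype.sum_prod_type]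
      simp only [A]
      rw [← Finset.sum_add_distrib]
      refine Finset.sum_congr rfl fun i _ => ?_
      have hh : ∀ b, (Jmat K m * g.transpose) (i, b) q = g q (i, !b) := by
        intro b
        rw [Matrix.mul_apply, Finset.sum_eq_single (i, !b)]
        · simp [Jmat]
        · rintro ⟨j, c⟩ _ hne
          have : ¬ (i = j ∧ b ≠ c) := by
            rintro ⟨h1, h2⟩
            apply hne
            subst h1
            cases b <;> cases c <;> simp_all
          simp [Jmat, this]
        · simp
      simp only [Fintype.sum_bool, hh]
      simp only [Bool.not_true, Bool.not_false]
      ring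
    have hNN : N p q + N q p = Jmat K m p q := by
      obtain ⟨i, b⟩ := p
      obtain ⟨j, c⟩ := q
      simp only [N, Jmat]
      cases b <;> cases c <;> simp [eq_comm]
    have : A p q + N p q + (A q p + N q p) = (A p q + A q p) + (N p q + N q p) := by ring
    rw [this, hNN, ← hS, hT]
    exact CharTwo.add_self_eq_zero _)
  simp only [add_smul, Finset.sum_add_distrib] at hz
  rw [← hA, ← hN] at hz
  have hneg : ∀ x : DR K (Fin m × Bool), -x = x := by
    intro x
    have : x + x = 0 := by
      rw [← two_smul K x, CharTwo.two_eq_zero, zero_smul]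
    exact neg_eq_of_add_eq_zero_left this
  rw [eq_neg_of_add_eq_zero_left hz, hneg]

end Sympl

section Homotopy

variable {K : Type} [Field K] {m : ℕ}

/-- Parity of the exponent of the pair `x_i, y_i`. -/
def pe (e : (Fin m × Bool) →₀ ℕ) (i : Fin m) : ℕ := (e (i, false) + e (i, true)) % 2

/-- Critical multi-indices: for each `i` exactly one of the two exponents is odd. -/
def crit (e : (Fin m × Bool) →₀ ℕ) : Prop := ∀ i, pe e i = 1

open Classical in
/-- Projection onto critical monomials. -/
def prj (K : Type) [Field K] (m : ℕ) : DPA K (Fin m × Bool) →ₗ[K] DPA K (Fin m × Bool) :=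
  Finsupp.linearCombination K (fun e => if crit e then Finsupp.single e (1 : K) else 0)

theorem prj_crit (e : (Fin m × Bool) →₀ ℕ) (r : K) (h : crit e) :
    prj K m (Finsupp.single e r) = Finsupp.single e r := by
  simp [prj, h]

theorem prj_ncrit (e : (Fin m × Bool) →₀ ℕ) (r : K) (h : ¬ crit e) :
    prj K m (Finsupp.single e r) = 0 := by
  simp [prj, h]

open Classical in
/-- Auxiliary function for the homotopy. -/
def hmAux (K : Type) [Field K] (s : Fin m → ℕ) (e : (Fin m × Bool) →₀ ℕ) :
    DPA K (Fin m × Bool) :=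
  if h : ∃ i, s i = 0 then
    (if e (h.choose, false) % 2 = 1 then Finsupp.single (e - xyIdx m h.choose) (1 : K) else 0)
  else 0

/-- The contracting homotopy. -/
def hm (K : Type) [Field K] (m : ℕ) : DPA K (Fin m × Bool) →ₗ[K] DPA K (Fin m × Bool) :=
  Finsupp.linearCombination K (fun e => hmAux K (pe e) e)

theorem hm_crit (e : (Fin m × Bool) →₀ ℕ) (r : K) (h : crit e) :
    hm K m (Finsupp.single e r) = 0 := by
  have : ¬ ∃ i, pe e i = 0 := by
    rintro ⟨i, hi⟩
    rw [h i] at hi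
    omega
  simp [hm, hmAux, this]

theorem hm_ncrit (K : Type) [Field K] (e : (Fin m × Bool) →₀ ℕ) (h : ¬ crit e) :
    ∃ i, pe e i = 0 ∧ ∀ e', pe e' = pe e → hm K m (Finsupp.single e' 1) =
      if e' (i, false) % 2 = 1 then Finsupp.single (e' - xyIdx m i) (1 : K) else 0 := by
  have hex : ∃ i, pe e i = 0 := by
    unfold crit at h
    push Not at h
    obtain ⟨i, hi⟩ := h
    refine ⟨i, ?_⟩
    unfold pe at *
    omega
  refine ⟨hex.choose, hex.choose_spec, ?_⟩
  intro e' he'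
  simp only [hm, Finsupp.linearCombination_single, one_smul, he', hmAux, dif_pos hex]

/-- Both exponents at `i` are even. -/
def EE (e : (Fin m × Bool) →₀ ℕ) (i : Fin m) : Prop :=
  e (i, false) % 2 = 0 ∧ e (i, true) % 2 = 0

theorem dpCoef_xy (e : (Fin m × Bool) →₀ ℕ) (i : Fin m) :
    dpCoef (xyIdx m i) e = (e (i, false) + 1) * (e (i, true) + 1) := by
  rw [dpCoef_eq, Fintype.prod_prod_type, Finset.prod_eq_single i]
  · simp [xyIdx_false, xyIdx_true, mul_comm, add_comm]
  · intro k _ hk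
    simp [xyIdx_false, xyIdx_true, Ne.symm hk]
  · simp

open Classical in
theorem del_single [CharP K 2] (e : (Fin m × Bool) →₀ ℕ) :
    del K m (Finsupp.single e 1)
      = ∑ j, if EE e j then Finsupp.single (e + xyIdx m j) (1 : K) else 0 := by
  unfold del omegaDP
  rw [map_sum, LinearMap.sum_apply]
  refine Finset.sum_congr rfl fun j _ => ?_
  rw [dpMul_single, dpCoef_xy, add_comm e]
  split_ifs with h
  · obtain ⟨h1, h2⟩ := h
    have : (((e (j, false) + 1) * (e (j, true) + 1) : ℕ) : K) = ((1 : ℕ) : K) := by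
      apply CharP.natCast_eq_natCast' K 2
      have a1 : (e (j, false) + 1) ≡ 1 [MOD 2] := by unfold Nat.ModEq; omega
      have a2 : (e (j, true) + 1) ≡ 1 [MOD 2] := by unfold Nat.ModEq; omega
      simpa using a1.mul a2
    rw [this]
    simp
  · have : (((e (j, false) + 1) * (e (j, true) + 1) : ℕ) : K) = 0 := by
      rw [CharP.cast_eq_zero_iff K 2]
      unfold EE at h
      by_cases h1 : e (j, false) % 2 = 0
      · have h2 : ¬ e (j, true) % 2 = 0 := fun h2 => h ⟨h1, h2⟩
        exact Dvd.dvd.mul_left (by omega) _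
      · exact Dvd.dvd.mul_right (by omega) _
    rw [this]
    simp

theorem pe_add_xy (e : (Fin m × Bool) →₀ ℕ) (j : Fin m) : pe (e + xyIdx m j) = pe e := by
  funext i
  simp only [pe, Finsupp.add_apply, xyIdx_false, xyIdx_true]
  split_ifs <;> omega

theorem del_crit [CharP K 2] (e : (Fin m × Bool) →₀ ℕ) (h : crit e) :
    del K m (Finsupp.single e 1) = 0 := by
  classical
  rw [del_single]
  refine Finset.sum_eq_zero fun j _ => ?_
  rw [if_neg]
  rintro ⟨h1, h2⟩
  have := h j
  unfold pe at this
  omega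

theorem prj_del [CharP K 2] (p : DPA K (Fin m × Bool)) : prj K m (del K m p) = 0 := by
  classical
  have : (prj K m).comp (del K m) = 0 := by
    ext e : 2
    simp only [LinearMap.coe_comp, Function.comp_apply, Finsupp.lsingle_apply]
    by_cases h : crit e
    · rw [del_crit e h]; simp
    · rw [del_single, map_sum]
      simp only [LinearMap.zero_comp, LinearMap.zero_apply]
      refine Finset.sum_eq_zero fun j _ => ?_
      split_ifs
      · rw [prj_ncrit]
        intro hc
        apply h
        unfold crit at *
        rwa [pe_add_xy] at hc
      · simp
  exact LinearMap.congr_fun this p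

theorem homotopy_single [CharP K 2] (e : (Fin m × Bool) →₀ ℕ) (h : ¬ crit e) :
    del K m (hm K m (Finsupp.single e 1)) + hm K m (del K m (Finsupp.single e 1))
      = Finsupp.single e (1 : K) := by
  classical
  obtain ⟨i, hi, H⟩ := hm_ncrit K e h
  unfold pe at hi
  have hd : hm K m (del K m (Finsupp.single e 1)) = ∑ j, if EE e j then
      (if (e + xyIdx m j) (i, false) % 2 = 1 then
        Finsupp.single (e + xyIdx m j - xyIdx m i) (1 : K) else 0) else 0 := by
    rw [del_single, map_sum]
    refine Finset.sum_congr rfl fun j _ => ?_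
    split_ifs with h1 h2 h3
    · rw [H _ (pe_add_xy e j), if_pos h2]
    · rw [H _ (pe_add_xy e j), if_neg h2]
    · simp
  by_cases hE : EE e i
  · rw [H e rfl, if_neg (by have := hE.1; omega), map_zero, zero_add, hd,
      Finset.sum_eq_single i]
    · rw [if_pos hE, if_pos, add_tsub_cancel_right]
      have := hE.1
      simp only [Finsupp.add_apply, xyIdx_false, if_true]
      omega
    · intro j _ hj
      split_ifs with h1 h2
      · exfalso
        have := hE.1
        simp only [Finsupp.add_apply, xyIdx_false, if_neg hj] at h2
        omega
      · rfl
      · rfl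
    · simp
  · have ho : e (i, false) % 2 = 1 ∧ e (i, true) % 2 = 1 := by
      unfold EE at hE
      omega
    obtain ⟨e0, he0⟩ : ∃ e0, e = e0 + xyIdx m i := by
      refine ⟨e - xyIdx m i, ?_⟩
      rw [tsub_add_cancel_of_le]
      intro p
      obtain ⟨j, b⟩ := p
      cases b
      · rw [xyIdx_false]
        split_ifs with hij
        · subst hij; omega
        · exact Nat.zero_le _
      · rw [xyIdx_true]
        split_ifs with hij
        · subst hij; omega
        · exact Nat.zero_le _
    have hE0 : EE e0 i := by
      rw [he0] at ho
      simp only [Finsupp.add_apply, xyIdx_false, xyIdx_true, if_true] at ho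
      unfold EE
      omega
    rw [H e rfl, if_pos ho.1, hd]
    have hs : e - xyIdx m i = e0 := by rw [he0, add_tsub_cancel_right]
    rw [hs, del_single, ← Finset.sum_add_distrib, Finset.sum_eq_single i]
    · rw [if_pos hE0, if_neg hE, add_zero, ← he0]
    · intro j _ hj
      have hEj : EE e j ↔ EE e0 j := by
        rw [he0]
        unfold EE
        simp only [Finsupp.add_apply, xyIdx_false, xyIdx_true, if_neg (Ne.symm hj), add_zero]
      by_cases h1 : EE e0 j
      · rw [if_pos h1, if_pos (hEj.2 h1), if_pos]
        · have : e + xyIdx m j - xyIdx m i = e0 + xyIdx m j := by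
            rw [he0, add_right_comm, add_tsub_cancel_right]
          rw [this, ← Finsupp.single_add, CharTwo.add_self_eq_zero, Finsupp.single_zero]
        · simp only [Finsupp.add_apply, xyIdx_false, if_neg hj]
          omega
      · rw [if_neg h1, if_neg (fun h2 => h1 (hEj.1 h2)), add_zero]
    · simp

theorem homotopy [CharP K 2] (p : DPA K (Fin m × Bool)) :
    del K m (hm K m p) + hm K m (del K m p) + prj K m p = p := by
  have : (del K m).comp (hm K m) + (hm K m).comp (del K m) + prj K m = LinearMap.id := by
    refine Finsupp.lhom_ext' fun e => LinearMap.ext_ring ?_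
    simp only [LinearMap.coe_comp, Function.comp_apply, Finsupp.lsingle_apply,
      LinearMap.add_apply, LinearMap.id_apply]
    by_cases h : crit e
    · rw [hm_crit e 1 h, del_crit e h, prj_crit e 1 h]
      simp
    · rw [homotopy_single e h, prj_ncrit e 1 h, add_zero]
  exact LinearMap.congr_fun this p

theorem Dsub_eq (K ι : Type) [Field K] (k : ℕ) :
    Dsub K ι k = Finsupp.supported K K {a : ι →₀ ℕ | deg a = k} := by
  rw [Finsupp.supported_eq_span_single]
  unfold Dsub
  congr 1
  ext f
  constructor
  · rintro ⟨a, h, rfl⟩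
    exact ⟨a, h, rfl⟩
  · rintro ⟨a, h, rfl⟩
    exact ⟨a, h, rfl⟩

theorem single_mem_Dsub {ι : Type} (a : ι →₀ ℕ) (k : ℕ) (h : deg a = k) (r : K) :
    Finsupp.single a r ∈ Dsub K ι k := by
  rw [Dsub_eq]
  exact Finsupp.single_mem_supported K r h

theorem deg_add {ι : Type} [Fintype ι] (a b : ι →₀ ℕ) : deg (a + b) = deg a + deg b := by
  simp [deg_eq, Finset.sum_add_distrib]

theorem deg_xy (i : Fin m) : deg (xyIdx m i) = 2 := by
  rw [deg_eq, Fintype.sum_prod_type, Finset.sum_eq_single i]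
  · simp [xyIdx_false, xyIdx_true]
  · intro k _ hk
    simp [xyIdx_false, xyIdx_true, Ne.symm hk]
  · simp

theorem hm_mem (n : ℕ) (z : DPA K (Fin m × Bool)) (hz : z ∈ Dsub K (Fin m × Bool) n) :
    hm K m z ∈ Dsub K (Fin m × Bool) (n - 2) := by
  unfold Dsub at hz
  induction hz using Submodule.span_induction with
  | zero => simp
  | add x y _ _ hx hy => rw [map_add]; exact add_mem hx hy
  | smul r x _ hx => rw [map_smul]; exact Submodule.smul_mem _ _ hx
  | mem x hx =>
    obtain ⟨e, he, rfl⟩ := hx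
    by_cases h : crit e
    · rw [hm_crit e 1 h]; exact zero_mem _
    · obtain ⟨i, hi, H⟩ := hm_ncrit K e h
      rw [H e rfl]
      split_ifs with h1
      · apply single_mem_Dsub
        have : e - xyIdx m i + xyIdx m i = e := by
          rw [tsub_add_cancel_of_le]
          unfold pe at hi
          rintro ⟨j, b⟩
          cases b
          · rw [xyIdx_false]
            split_ifs with hij
            · subst hij; omega
            · exact Nat.zero_le _
          · rw [xyIdx_true]
            split_ifs with hij
            · subst hij; omega
            · exact Nat.zero_le _
        have h2 := congrArg deg this
        rw [deg_add, deg_xy] at h2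
        omega
      · exact zero_mem _

/-- Critical multi-indices of degree `n`. -/
def critSet (m n : ℕ) : Set ((Fin m × Bool) →₀ ℕ) := {e | crit e ∧ deg e = n}

theorem prj_mem (n : ℕ) (z : DPA K (Fin m × Bool)) (hz : z ∈ Dsub K (Fin m × Bool) n) :
    prj K m z ∈ Finsupp.supported K K (critSet m n) := by
  unfold Dsub at hz
  induction hz using Submodule.span_induction with
  | zero => simp
  | add x y _ _ hx hy => rw [map_add]; exact add_mem hx hy
  | smul r x _ hx => rw [map_smul]; exact Submodule.smul_mem _ _ hx
  | mem x hx =>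
    obtain ⟨e, he, rfl⟩ := hx
    by_cases h : crit e
    · rw [prj_crit e 1 h]
      exact Finsupp.single_mem_supported K 1 ⟨h, he⟩
    · rw [prj_ncrit e 1 h]; exact zero_mem _

theorem cocycle_decomp [CharP K 2] (n : ℕ) (z : DPA K (Fin m × Bool)) (hz : z ∈ Zmod K m n) :
    del K m (hm K m z) + prj K m z = z := by
  have h := homotopy z
  have h1 : del K m z = 0 := hz.1
  rw [h1, map_zero, add_zero] at h
  exact h

theorem mem_Bful_iff [CharP K 2] (n : ℕ) (z : DPA K (Fin m × Bool)) (hz : z ∈ Zmod K m n) :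
    z ∈ Bful K m n ↔ prj K m z = 0 := by
  constructor
  · rintro ⟨q, _, rfl⟩
    exact prj_del q
  · intro h
    have h1 := cocycle_decomp n z hz
    rw [h, add_zero] at h1
    exact ⟨hm K m z, hm_mem n z hz.2, h1⟩

theorem supported_le [CharP K 2] (n : ℕ) (z : DPA K (Fin m × Bool))
    (hz : z ∈ Finsupp.supported K K (critSet m n)) : z ∈ Zmod K m n ∧ prj K m z = z := by
  rw [Finsupp.supported_eq_span_single] at hz
  induction hz using Submodule.span_induction with
  | zero => exact ⟨zero_mem _, map_zero _⟩
  | add x y _ _ hx hy => exact ⟨add_mem hx.1 hy.1, by rw [map_add, hx.2, hy.2]⟩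
  | smul r x _ hx => exact ⟨Submodule.smul_mem _ _ hx.1, by rw [map_smul, hx.2]⟩
  | mem x hx =>
    obtain ⟨e, he, rfl⟩ := hx
    exact ⟨⟨del_crit e he.1, single_mem_Dsub e n he.2 1⟩, prj_crit e 1 he.1⟩

end Homotopy

section Final

variable {K : Type} [Field K] {m : ℕ}

theorem deg_pair (e : (Fin m × Bool) →₀ ℕ) : deg e = ∑ i, (e (i, false) + e (i, true)) := by
  rw [deg_eq, Fintype.sum_prod_type]
  simp [add_comm]

theorem critSet_sqfree (c : (Fin m × Bool) →₀ ℕ) (hc : c ∈ critSet m m) (i : Fin m) :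
    c (i, false) + c (i, true) = 1 := by
  obtain ⟨h1, h2⟩ := hc
  have hle : ∀ i ∈ (Finset.univ : Finset (Fin m)), 1 ≤ c (i, false) + c (i, true) := by
    intro i _
    have := h1 i
    unfold pe at this
    omega
  have hs : ∑ i : Fin m, 1 = ∑ i : Fin m, (c (i, false) + c (i, true)) := by
    rw [← deg_pair, h2]
    simp
  exact ((Finset.sum_eq_sum_iff_of_le hle).1 hs i (Finset.mem_univ i)).symm

theorem critSet_le_one (c : (Fin m × Bool) →₀ ℕ) (hc : c ∈ critSet m m) (p : Fin m × Bool) :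
    c p ≤ 1 := by
  obtain ⟨i, b⟩ := p
  have := critSet_sqfree c hc i
  cases b <;> omega

/-- The map `(a, c) ↦ 2a + c` on multi-indices. -/
def idxMap (m k : ℕ) (x : {a : (Fin m × Bool) →₀ ℕ | deg a = k} × critSet m m) :
    critSet m (m + 2 * k) :=
  ⟨x.1.1 + x.1.1 + x.2.1, by
    obtain ⟨⟨a, ha⟩, ⟨c, hc⟩⟩ := x
    refine ⟨fun i => ?_, ?_⟩
    · have := critSet_sqfree c hc i
      simp only [pe, Finsupp.add_apply]
      omega
    · have h1 : deg a = k := ha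
      have h2 := hc.2
      simp only [deg_add]
      omega⟩

theorem idxMap_bij (m k : ℕ) : Function.Bijective (idxMap m k) := by
  constructor
  · rintro ⟨⟨a, ha⟩, ⟨c, hc⟩⟩ ⟨⟨a', ha'⟩, ⟨c', hc'⟩⟩ h
    have h0 : a + a + c = a' + a' + c' := congrArg Subtype.val h
    have h1 : ∀ p, a p = a' p ∧ c p = c' p := by
      intro p
      have e1 := DFunLike.congr_fun h0 p
      simp only [Finsupp.add_apply] at e1
      have := critSet_le_one c hc p
      have := critSet_le_one c' hc' p
      omega
    have ea : a = a' := Finsupp.ext fun p => (h1 p).1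
    have ec : c = c' := Finsupp.ext fun p => (h1 p).2
    subst ea ec
    rfl
  · rintro ⟨e, he⟩
    have hsum : halfIdx e + halfIdx e + e.mapRange (fun n => n % 2) rfl = e := by
      ext p
      simp only [halfIdx, Finsupp.mapRange_apply, Finsupp.add_apply]
      omega
    have hpair : ∀ i : Fin m, e (i, false) % 2 + e (i, true) % 2 = 1 := by
      intro i
      have := he.1 i
      unfold pe at this
      omega
    have hc : e.mapRange (fun n => n % 2) rfl ∈ critSet m m := by
      refine ⟨fun i => ?_, ?_⟩
      · have := hpair i
        simp only [pe, Finsupp.mapRange_apply]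
        omega
      · rw [deg_pair]
        simp only [Finsupp.mapRange_apply, hpair]
        simp
    have ha : deg (halfIdx e) = k := by
      have h1 := congrArg deg hsum
      rw [deg_add, deg_add, hc.2, he.2] at h1
      omega
    exact ⟨(⟨halfIdx e, ha⟩, ⟨_, hc⟩), Subtype.ext hsum⟩

/-- The class of a cocycle is determined by its critical part. -/
def rhoAux (K : Type) [Field K] [CharP K 2] (m n : ℕ) :
    Hcoh K m n →ₗ[K] ↥(Finsupp.supported K K (critSet m n)) :=
  LinearMap.codRestrict _
    (((Bful K m n).liftQ (prj K m) (by
      rintro _ ⟨q, _, rfl⟩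
      exact prj_del q)).comp (Submodule.subtype _)) (by
    rintro ⟨_, ⟨z, hz, rfl⟩⟩
    exact prj_mem n z hz.2)

theorem rhoAux_toH [CharP K 2] (n : ℕ) (z : ↥(Zmod K m n)) :
    (rhoAux K m n (toH K m n z) : DPA K (Fin m × Bool)) = prj K m z := rfl

theorem toH_surj (n : ℕ) : Function.Surjective (toH K m n) := by
  rintro ⟨_, ⟨z, hz, rfl⟩⟩
  exact ⟨⟨z, hz⟩, rfl⟩

theorem rhoAux_bij [CharP K 2] (n : ℕ) : Function.Bijective (rhoAux K m n) := by
  constructor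
  · refine (injective_iff_map_eq_zero (rhoAux K m n)).2 ?_
    intro x hx
    obtain ⟨z, rfl⟩ := toH_surj n x
    have h1 : prj K m z = 0 := by
      rw [← rhoAux_toH, hx]
      rfl
    have h2 := (mem_Bful_iff n z.1 z.2).2 h1
    apply Subtype.ext
    exact (Submodule.Quotient.mk_eq_zero _).2 h2
  · rintro ⟨z, hz⟩
    obtain ⟨h1, h2⟩ := supported_le n z hz
    refine ⟨toH K m n ⟨z, h1⟩, Subtype.ext ?_⟩
    rw [rhoAux_toH, h2]

/-- Cohomology is the space of critical monomials. -/
def rho (K : Type) [Field K] [CharP K 2] (m n : ℕ) :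
    Hcoh K m n ≃ₗ[K] ↥(Finsupp.supported K K (critSet m n)) :=
  LinearEquiv.ofBijective (rhoAux K m n) (rhoAux_bij n)

theorem rho_toH [CharP K 2] (n : ℕ) (z : ↥(Zmod K m n)) :
    (rho K m n (toH K m n z) : DPA K (Fin m × Bool)) = prj K m z := rfl

theorem toH_eq_iff [CharP K 2] (n : ℕ) (x : Hcoh K m n) (z : ↥(Zmod K m n)) :
    x = toH K m n z ↔ (rho K m n x : DPA K (Fin m × Bool)) = prj K m z := by
  rw [← rho_toH]
  constructor
  · rintro rfl; rfl
  · intro h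
    exact (rho K m n).injective (Subtype.ext h)

/-- The isomorphism. -/
def PhiEquiv (K : Type) [Field K] [CharP K 2] (m k : ℕ) :
    (↥(Dsub K (Fin m × Bool) k) ⊗[K] Hcoh K m m) ≃ₗ[K] Hcoh K m (m + 2 * k) :=
  (TensorProduct.congr
    ((LinearEquiv.ofEq _ _ (Dsub_eq K (Fin m × Bool) k)).trans
      (Finsupp.supportedEquivFinsupp {a : (Fin m × Bool) →₀ ℕ | deg a = k}))
    ((rho K m m).trans (Finsupp.supportedEquivFinsupp (critSet m m)))).trans
  ((finsuppTensorFinsupp' K _ _).trans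
    ((Finsupp.domLCongr (Equiv.ofBijective (idxMap m k) (idxMap_bij m k))).trans
      ((rho K m (m + 2 * k)).trans
        (Finsupp.supportedEquivFinsupp (critSet m (m + 2 * k)))).symm))

theorem dpCoef_even_sqfree [CharP K 2] (a c : (Fin m × Bool) →₀ ℕ) (hc : c ∈ critSet m m) :
    (dpCoef (a + a) c : K) = 1 := by
  rw [dpCoef_eq, Nat.cast_prod]
  refine Finset.prod_eq_one fun p _ => ?_
  have := critSet_le_one c hc p
  rw [Finsupp.add_apply]
  have h2 : c p = 0 ∨ c p = 1 := by omega
  rcases h2 with h2 | h2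
  · rw [h2]; simp
  · rw [h2, Nat.choose_succ_self_right]
    push_cast
    rw [CharTwo.add_self_eq_zero, zero_add]

theorem sEF_single {α : Type} (s : Set α) (a : α) (ha : a ∈ s) (r : K)
    (h : Finsupp.single a r ∈ Finsupp.supported K K s) :
    Finsupp.supportedEquivFinsupp (M := K) (R := K) s ⟨Finsupp.single a r, h⟩
      = Finsupp.single ⟨a, ha⟩ r := by
  classical
  ext ⟨b, hb⟩
  simp [Finsupp.single_apply]

theorem sEF_symm_single {α : Type} (s : Set α) (a : s) (r : K) :
    (((Finsupp.supportedEquivFinsupp (M := K) (R := K) s).symm (Finsupp.single a r) :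
      Finsupp.supported K K s) : α →₀ K) = Finsupp.single a.1 r := by
  have h : Finsupp.single a.1 r ∈ Finsupp.supported K K s :=
    Finsupp.single_mem_supported K r a.2
  rw [← sEF_single s a.1 a.2 r h, LinearEquiv.symm_apply_apply]

theorem Phi_basis [CharP K 2] (k : ℕ) (a c : (Fin m × Bool) →₀ ℕ) (ha : deg a = k)
    (hc : c ∈ critSet m m) (h1 : Finsupp.single a (1 : K) ∈ Dsub K (Fin m × Bool) k)
    (h2 : Finsupp.single c (1 : K) ∈ Finsupp.supported K K (critSet m m)) :
    (rho K m (m + 2 * k) (PhiEquiv K m k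
      ((⟨Finsupp.single a 1, h1⟩ : ↥(Dsub K (Fin m × Bool) k)) ⊗ₜ[K]
        (rho K m m).symm ⟨Finsupp.single c 1, h2⟩)) : DPA K (Fin m × Bool))
      = dpMul K (Fin m × Bool) (Finsupp.single (a + a) 1) (Finsupp.single c 1) := by
  have e1 : (LinearEquiv.ofEq _ _ (Dsub_eq K (Fin m × Bool) k)) ⟨Finsupp.single a 1, h1⟩
      = ⟨Finsupp.single a 1, by rw [← Dsub_eq]; exact h1⟩ := rfl
  simp only [PhiEquiv, LinearEquiv.trans_apply, TensorProduct.congr_tmul, e1,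
    LinearEquiv.apply_symm_apply, LinearEquiv.trans_symm]
  rw [sEF_single _ a ha, sEF_single _ c hc, finsuppTensorFinsupp'_single_tmul_single,
    Finsupp.domLCongr_single, sEF_symm_single, dpMul_single, dpCoef_even_sqfree a c hc]
  simp [idxMap]

theorem span_ext {V M : Type} [AddCommMonoid V] [Module K V] [AddCommMonoid M] [Module K M]
    (S : Set V) (W : Submodule K V) (hW : W = Submodule.span K S) (F G : ↥W →ₗ[K] M)
    (h : ∀ x (_ : x ∈ S) (h1 : x ∈ W), F ⟨x, h1⟩ = G ⟨x, h1⟩) : F = G := by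
  subst hW
  ext ⟨x, hx⟩
  induction hx using Submodule.span_induction with
  | zero => exact (map_zero F).trans (map_zero G).symm
  | add x y hx hy ihx ihy =>
    have := congrArg₂ (· + ·) ihx ihy
    exact (map_add F ⟨x, hx⟩ ⟨y, hy⟩).trans (this.trans (map_add G ⟨x, hx⟩ ⟨y, hy⟩).symm)
  | smul r x hx ihx =>
    have := congrArg (r • ·) ihx
    exact (map_smul F r ⟨x, hx⟩).trans (this.trans (map_smul G r ⟨x, hx⟩).symm)
  | mem x hx => exact h x hx _

/-- The left hand side of the comparison, as a bilinear map. -/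
def bilA (K : Type) [Field K] [CharP K 2] (m k : ℕ) :
    ↥(Dsub K (Fin m × Bool) k) →ₗ[K] ↥(Finsupp.supported K K (critSet m m)) →ₗ[K]
      DPA K (Fin m × Bool) :=
  ((TensorProduct.mk K (↥(Dsub K (Fin m × Bool) k)) (Hcoh K m m)).compl₂
    (rho K m m).symm.toLinearMap).compr₂
    ((Finsupp.supported K K (critSet m (m + 2 * k))).subtype.comp
      ((PhiEquiv K m k).trans (rho K m (m + 2 * k))).toLinearMap)

/-- The right hand side of the comparison, as a bilinear map. -/
def bilB (K : Type) [Field K] (m k : ℕ) :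
    ↥(Dsub K (Fin m × Bool) k) →ₗ[K] ↥(Finsupp.supported K K (critSet m m)) →ₗ[K]
      DPA K (Fin m × Bool) :=
  (dpMul K (Fin m × Bool)).compl₁₂ ((dbl K _).comp (Submodule.subtype _)) (Submodule.subtype _)

theorem bil_eq [CharP K 2] (k : ℕ) : bilA K m k = bilB K m k := by
  refine span_ext (K := K) {f | ∃ a : (Fin m × Bool) →₀ ℕ, deg a = k ∧ f = Finsupp.single a (1 : K)}
    (Dsub K (Fin m × Bool) k) rfl (bilA K m k) (bilB K m k) ?_
  rintro _ ⟨a, ha, rfl⟩ h1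
  refine span_ext (K := K) _ (Finsupp.supported K K (critSet m m))
    (Finsupp.supported_eq_span_single K _) (bilA K m k ⟨_, h1⟩) (bilB K m k ⟨_, h1⟩) ?_
  rintro _ ⟨c, hc, rfl⟩ h2
  refine (Phi_basis k a c ha hc h1 h2).trans ?_
  simp only [bilB, LinearMap.compl₁₂_apply, LinearMap.comp_apply, Submodule.subtype_apply,
    dbl_single]

theorem Phi_supp [CharP K 2] (k : ℕ) (u : ↥(Dsub K (Fin m × Bool) k))
    (c : ↥(Finsupp.supported K K (critSet m m))) :
    (rho K m (m + 2 * k) (PhiEquiv K m k (u ⊗ₜ[K] (rho K m m).symm c)) : DPA K (Fin m × Bool))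
      = dpMul K (Fin m × Bool) (dbl K _ u) c :=
  LinearMap.congr_fun (LinearMap.congr_fun (bil_eq k) u) c

theorem dpMul_del (p q : DPA K (Fin m × Bool)) :
    dpMul K _ p (del K m q) = del K m (dpMul K _ p q) := by
  unfold del
  rw [← dpMul_assoc, dpMul_comm p, dpMul_assoc]

theorem prj_mul_cocycle [CharP K 2] (n : ℕ) (p z : DPA K (Fin m × Bool)) (hz : z ∈ Zmod K m n) :
    prj K m (dpMul K _ p z) = prj K m (dpMul K _ p (prj K m z)) := by
  conv_lhs => rw [← cocycle_decomp n z hz, map_add, map_add, dpMul_del, prj_del, zero_add]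

theorem prj_mul_half_single [CharP K 2] (e c : (Fin m × Bool) →₀ ℕ) (hc : c ∈ critSet m m)
    (r s : K) :
    prj K m (dpMul K _ (Finsupp.single e r) (Finsupp.single c s))
      = prj K m (dpMul K _ (dbl K _ (half K _ (Finsupp.single e r))) (Finsupp.single c s)) := by
  by_cases he : ∀ p, e p % 2 = 0
  · rw [half_single_even e r he, dbl_single, halfIdx_dbl e he]
  · rw [half_single_odd e r he, map_zero, LinearMap.map_zero₂, map_zero, dpMul_single]
    by_cases hcr : crit (e + c)
    · push Not at he
      obtain ⟨⟨i, b⟩, hib⟩ := he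
      have h1 := critSet_sqfree c hc i
      have h2 := hcr i
      simp only [pe, Finsupp.add_apply] at h2
      have h3 : e (i, false) % 2 = 1 ∧ e (i, true) % 2 = 1 := by
        cases b <;> omega
      have h4 : c (i, false) = 1 ∨ c (i, true) = 1 := by omega
      have h5 : (dpCoef e c : K) = 0 := by
        rcases h4 with h4 | h4
        · exact dpCoef_odd_odd e c (i, false) h3.1 (by rw [h4])
        · exact dpCoef_odd_odd e c (i, true) h3.2 (by rw [h4])
      rw [h5]
      simp
    · exact prj_ncrit _ _ hcr

theorem prj_mul_half [CharP K 2] (p c : DPA K (Fin m × Bool))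
    (hc : c ∈ Finsupp.supported K K (critSet m m)) :
    prj K m (dpMul K _ p c) = prj K m (dpMul K _ (dbl K _ (half K _ p)) c) := by
  rw [Finsupp.supported_eq_span_single] at hc
  induction hc using Submodule.span_induction with
  | zero => simp
  | add x y _ _ hx hy => simp only [map_add, hx, hy]
  | smul r x _ hx => simp only [map_smul, hx]
  | mem x hx =>
    obtain ⟨c, hc, rfl⟩ := hx
    induction p using Finsupp.induction_linear with
    | zero => simp
    | add p p' h h' => simp only [map_add, LinearMap.add_apply, h, h']
    | single e r => exact prj_mul_half_single e c hc r 1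

theorem Phi_toH [CharP K 2] (k : ℕ) (u : ↥(Dsub K (Fin m × Bool) k)) (z : ↥(Zmod K m m)) :
    (rho K m (m + 2 * k) (PhiEquiv K m k (u ⊗ₜ[K] toH K m m z)) : DPA K (Fin m × Bool))
      = prj K m (dpMul K (Fin m × Bool) (dbl K _ u) z) := by
  have h1 : toH K m m z = (rho K m m).symm (rho K m m (toH K m m z)) := by simp
  have h3 := (rho K m (m + 2 * k) (PhiEquiv K m k (u ⊗ₜ[K] toH K m m z))).2
  have h4 := (supported_le _ _ h3).2
  rw [← h4, h1, Phi_supp, rho_toH, prj_mul_cocycle m _ _ z.2]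

end Final

/-- `H^{m+2k}(DV) ≅ (D_k V)^{(1)} ⊗ H^m(DV)` as `Sp(V)`-modules, via the
map induced by `u ⊗ (v + Im ∂_{m-2}) ↦ u' v + Im ∂_{m+2k-2}`, where `u'` is obtained from
`u` by doubling all exponents, and where `g ∈ Sp(V)` acts on the Frobenius twist
`(D_k V)^{(1)}` through the entrywise square `g^{[2]}`. -/
theorem statement_13 (K : Type) [Field K] [CharP K 2] (m k : ℕ) (hm : 1 ≤ m) :
    ∃ Φ : (↥(Dsub K (Fin m × Bool) k) ⊗[K] Hcoh K m m) ≃ₗ[K] Hcoh K m (m + 2 * k),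
      (∀ (a : (Fin m × Bool) →₀ ℕ) (_ : deg a = k)
          (h1 : Finsupp.single a (1 : K) ∈ Dsub K (Fin m × Bool) k)
          (z : ↥(Zmod K m m)) (w : ↥(Zmod K m (m + 2 * k))),
        (w : DPA K (Fin m × Bool))
            = dpMul K (Fin m × Bool) (Finsupp.single (a + a) 1) ↑z →
        Φ ((⟨Finsupp.single a 1, h1⟩ : ↥(Dsub K (Fin m × Bool) k)) ⊗ₜ[K] toH K m m z)
          = toH K m (m + 2 * k) w) ∧
      (∀ g : Matrix (Fin m × Bool) (Fin m × Bool) K, IsSymplectic g →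
        ∀ (u u' : ↥(Dsub K (Fin m × Bool) k)) (z z' : ↥(Zmod K m m))
          (w w' : ↥(Zmod K m (m + 2 * k))),
          (u' : DPA K (Fin m × Bool)) = act (matSq g) ↑u →
          (z' : DPA K (Fin m × Bool)) = act g ↑z →
          (w' : DPA K (Fin m × Bool)) = act g ↑w →
          Φ (u ⊗ₜ[K] toH K m m z) = toH K m (m + 2 * k) w →
          Φ (u' ⊗ₜ[K] toH K m m z') = toH K m (m + 2 * k) w') := by
  refine ⟨PhiEquiv K m k, ?_, ?_⟩
  · intro a ha h1 z w hw
    rw [toH_eq_iff, Phi_toH, hw]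
    dsimp only
    rw [dbl_single]
  · intro g hg u u' z z' w w' hu hz hw h
    rw [toH_eq_iff, Phi_toH] at h ⊢
    have hdel : ∀ q, prj K m (act g (del K m q)) = 0 := by
      intro q
      unfold del
      rw [act_mul, act_omega g hg]
      exact prj_del _
    have hinv : ∀ n, ∀ y ∈ Zmod K m n, prj K m (act g y) = prj K m (act g (prj K m y)) := by
      intro n y hy
      conv_lhs => rw [← cocycle_decomp n y hy, map_add, map_add, hdel, zero_add]
    have hprod : dpMul K (Fin m × Bool) (dbl K _ u) z ∈ LinearMap.ker (del K m) := by
      rw [LinearMap.mem_ker, ← dpMul_del]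
      have : del K m z = 0 := z.2.1
      rw [this, map_zero]
    have hinv' : prj K m (act g (dpMul K (Fin m × Bool) (dbl K _ u) z))
        = prj K m (act g (prj K m (dpMul K (Fin m × Bool) (dbl K _ u) z))) := by
      have h1 := homotopy (dpMul K (Fin m × Bool) (dbl K _ (u : DPA K (Fin m × Bool))) z)
      rw [LinearMap.mem_ker.1 hprod, map_zero, add_zero] at h1
      conv_lhs => rw [← h1, map_add, map_add, hdel, zero_add]
    rw [hw, hinv _ w w.2, ← h, ← hinv', act_mul, ← hz]
    rw [prj_mul_cocycle m _ _ z'.2, prj_mul_cocycle m (act g _) _ z'.2,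
      prj_mul_half (act g _) _ (prj_mem m _ z'.2.2), half_act_dbl, hu]
end
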